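/- arXiv:2409.10745 — 2 statements merged into one kernel-verified Lean document; each statement's English description precedes it below -/
import Mathlib

section
/- Let (X,G,α) be a topological dynamical system and k ∈ ℕ. Then the maximal pattern entropy of the diagonal product action of G on X^k is k times that of the original action: h*_{top}(X^k,G,α^k) = k · h*_{top}(X,G,α). -/
open Filter Topology Set
open scoped ENNReal Classical

section EntropyDefs

variable {G X : Type*}

/-- `𝒰` is an open cover of `X`. -/
def IsOpenCover [TopologicalSpace X] (𝒰 : Set (Set X)) : Prop :=
  (∀ U ∈ 𝒰, IsOpen U) ∧ ⋃₀ 𝒰 = Set.univ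

/-- `N(𝒰)`: the minimal cardinality of a finite subcover of `𝒰`
(junk value `0` if no finite subcover exists). -/
noncomputable def coverN (𝒰 : Set (Set X)) : ℕ :=
  sInf {n : ℕ | ∃ F : Finset (Set X), ↑F ⊆ 𝒰 ∧ F.card = n ∧ ⋃₀ (F : Set (Set X)) = Set.univ}

/-- The join `⋁_{i=1}^n α_{g_i⁻¹}(𝒰)` of the covers `α_{g_i⁻¹}(𝒰) = (α g_i)⁻¹'(𝒰)`. -/
def joinPull (α : G → X → X) (𝒰 : Set (Set X)) {n : ℕ} (g : Fin n → G) : Set (Set X) :=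
  {V | ∃ U : Fin n → Set X, (∀ i, U i ∈ 𝒰) ∧ V = ⋂ i, α (g i) ⁻¹' U i}

/-- Topological sequence entropy of the cover `𝒰` along the sequence `𝔰`:
`h_top^𝔰(𝒰,G) = limsup_n (1/n) log N(⋁_{i=1}^n α_{𝔰(i)⁻¹}(𝒰))`, valued in `[0,∞]`. -/
noncomputable def seqEntCover (α : G → X → X) (𝔰 : ℕ → G) (𝒰 : Set (Set X)) : ℝ≥0∞ :=
  Filter.atTop.limsup fun n : ℕ =>
    ENNReal.ofReal (Real.log (coverN (joinPull α 𝒰 fun i : Fin n => 𝔰 i)) / n)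

/-- Topological sequence entropy of the action along `𝔰`: supremum over all open covers. -/
noncomputable def seqEnt [TopologicalSpace X] (α : G → X → X) (𝔰 : ℕ → G) : ℝ≥0∞ :=
  ⨆ 𝒰 ∈ {𝒰 : Set (Set X) | IsOpenCover 𝒰}, seqEntCover α 𝔰 𝒰

/-- `p*_{X,G,𝒰}(n) = max_{(g_1,…,g_n) ∈ Gⁿ} N(⋁_{i=1}^n α_{g_i⁻¹}(𝒰))`. -/
noncomputable def patN (α : G → X → X) (𝒰 : Set (Set X)) (n : ℕ) : ℕ :=
  sSup {m : ℕ | ∃ g : Fin n → G, m = coverN (joinPull α 𝒰 g)}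

/-- Maximal pattern entropy of the cover `𝒰`: `lim_n (1/n) log p*_{X,G,𝒰}(n)`
(the limit exists by subadditivity and coincides with the limsup used here). -/
noncomputable def patEntCover (α : G → X → X) (𝒰 : Set (Set X)) : ℝ≥0∞ :=
  Filter.atTop.limsup fun n : ℕ => ENNReal.ofReal (Real.log (patN α 𝒰 n) / n)

/-- Maximal pattern entropy `h*_top(X,G)`: supremum over all open covers. -/
noncomputable def patEnt [TopologicalSpace X] (α : G → X → X) : ℝ≥0∞ :=
  ⨆ 𝒰 ∈ {𝒰 : Set (Set X) | IsOpenCover 𝒰}, patEntCover α 𝒰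

/-- `α` is an action of `G` on `X` by homeomorphisms. -/
def IsActionBy [Group G] [TopologicalSpace X] (α : G → X → X) : Prop :=
  (∀ x, α 1 x = x) ∧ (∀ g h x, α (g * h) x = α g (α h x)) ∧ ∀ g, Continuous (α g)

/-- `I ⊆ G` is an independence set for the tuple `(A 1, …, A k)`:
for every nonempty finite `F ⊆ I` and every `ω : F → {1,…,k}` we have
`⋂_{g ∈ F} α_{g⁻¹}(A (ω g)) ≠ ∅`. -/
def IsIndepSet (α : G → X → X) {k : ℕ} (A : Fin k → Set X) (I : Set G) : Prop :=
  ∀ F : Finset G, ↑F ⊆ I → F.Nonempty → ∀ ω : G → Fin k,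
    (⋂ g ∈ F, α g ⁻¹' A (ω g)).Nonempty

/-- The tuple `(A 1, …, A k)` has arbitrarily large finite independence sets. -/
def HasArbLargeIndep (α : G → X → X) {k : ℕ} (A : Fin k → Set X) : Prop :=
  ∀ n : ℕ, ∃ F : Finset G, n ≤ F.card ∧ IsIndepSet α A ↑F

/-- `(x 1, …, x k)` is an IN-tuple: every product neighbourhood has arbitrarily large
finite independence sets. -/
def IsINTuple [TopologicalSpace X] (α : G → X → X) {k : ℕ} (x : Fin k → X) : Prop :=
  ∀ U : Fin k → Set X, (∀ i, IsOpen (U i)) → (∀ i, x i ∈ U i) → HasArbLargeIndep α U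

/-- The action `α` of `G` on `X` is (topologically) weak-mixing. -/
def IsWeakMixing [TopologicalSpace X] (α : G → X → X) : Prop :=
  ∀ U₁ U₂ V₁ V₂ : Set X, IsOpen U₁ → IsOpen U₂ → IsOpen V₁ → IsOpen V₂ →
    U₁.Nonempty → U₂.Nonempty → V₁.Nonempty → V₂.Nonempty →
    ∃ g : G, (U₁ ∩ α g '' V₁).Nonempty ∧ (U₂ ∩ α g '' V₂).Nonempty

/-- `(x₁,x₂)` is a sequence entropy pair. -/
def IsSeqEntropyPair [TopologicalSpace X] (α : G → X → X) (x₁ x₂ : X) : Prop :=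
  x₁ ≠ x₂ ∧ ∀ A₁ A₂ : Set X, IsClosed A₁ → IsClosed A₂ →
    A₁ ∈ nhds x₁ → A₂ ∈ nhds x₂ → Disjoint A₁ A₂ →
    ∃ 𝔰 : ℕ → G, 0 < seqEntCover α 𝔰 {A₁ᶜ, A₂ᶜ}

/-- `(x 1, …, x k)` is a sequence entropy tuple: it is not diagonal, and whenever
`U i` are closed neighbourhoods of the `x i` which coincide on equal coordinates and are
pairwise disjoint on distinct coordinates (i.e. pairwise disjoint closed neighbourhoods of
the distinct points of the tuple), some sequence gives positive sequence entropy for the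
cover by their complements. -/
def IsSeqEntropyTuple [TopologicalSpace X] (α : G → X → X) {k : ℕ} (x : Fin k → X) : Prop :=
  (∃ i j, x i ≠ x j) ∧ ∀ U : Fin k → Set X,
    (∀ i, IsClosed (U i)) → (∀ i, U i ∈ nhds (x i)) →
    (∀ i j, x i = x j → U i = U j) → (∀ i j, x i ≠ x j → Disjoint (U i) (U j)) →
    ∃ 𝔰 : ℕ → G, 0 < seqEntCover α 𝔰 (Set.range fun i => (U i)ᶜ)

end EntropyDefs

namespace CoInd

variable {G : Type*} [Group G] (H : Subgroup G)

/-- `H\G`, the space of right cosets of `H` in `G`. -/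
abbrev RQ := Quotient (QuotientGroup.rightRel H)

/-- Right multiplication `Hg ↦ H(g·g₀)` on the right coset space. -/
def rmul (g₀ : G) : RQ H → RQ H :=
  Quotient.map' (fun g => g * g₀) (fun a b hab => by
    rw [QuotientGroup.rightRel_apply] at hab ⊢
    have h2 : b * g₀ * (a * g₀)⁻¹ = b * a⁻¹ := by group
    rw [h2]; exact hab)

/-- `s : H\G → G` is a section of the right cosets with `s(H) = e`. -/
def IsSection (s : RQ H → G) : Prop :=
  (∀ θ : RQ H, Quotient.mk'' (s θ) = θ) ∧ s (Quotient.mk'' 1) = 1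

variable {X : Type*}

/-- The co-induced action `α^{H\G}` of `G` on `X_H^G = ∏_{θ ∈ H\G} X`, relative to a
section `s` of the right cosets:
`(α^{H\G}_{g₀} f)(Hg) = α_{s(Hg)·g₀·s(Hg·g₀)⁻¹} (f (Hg·g₀))`.
(When `s` is a genuine section the element `s(Hg)·g₀·s(Hg·g₀)⁻¹` always lies in `H`,
so the `else` branch is never taken.) -/
noncomputable def coindAct (α : ↥H → X → X) (s : RQ H → G) (g₀ : G)
    (f : RQ H → X) : RQ H → X := fun θ =>
  if h : s θ * g₀ * (s (rmul H g₀ θ))⁻¹ ∈ H then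
    α ⟨s θ * g₀ * (s (rmul H g₀ θ))⁻¹, h⟩ (f (rmul H g₀ θ))
  else f (rmul H g₀ θ)

end CoInd

section CoverNumber

variable {X : Type*}

/-- A finite covering family refining `𝒰` bounds the minimal cardinality of a subcover. -/
lemma coverN_le_card {ι : Type*} [Fintype ι] {𝒰 : Set (Set X)} (s : ι → Set X)
    (hs : ∀ x, ∃ a, x ∈ s a) (hs' : ∀ a, ∃ U ∈ 𝒰, s a ⊆ U) :
    coverN 𝒰 ≤ Fintype.card ι := by
  choose u hu hsu using hs'
  refine le_trans (Nat.sInf_le ⟨Finset.univ.image u, ?_, rfl, ?_⟩) Finset.card_image_le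
  · intro V hV
    obtain ⟨a, -, rfl⟩ := Finset.mem_image.1 (Finset.mem_coe.1 hV)
    exact hu a
  · refine eq_univ_of_forall fun x => ?_
    obtain ⟨a, ha⟩ := hs x
    exact ⟨u a, by simp, hsu a ha⟩

lemma IsOpenCover.exists_card_eq_coverN [TopologicalSpace X] [CompactSpace X] {𝒰 : Set (Set X)}
    (h𝒰 : IsOpenCover 𝒰) :
    ∃ F : Finset (Set X), ↑F ⊆ 𝒰 ∧ F.card = coverN 𝒰 ∧ ⋃₀ (F : Set (Set X)) = Set.univ := by
  obtain ⟨T, hT, hTfin, hTcov⟩ :=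
    isCompact_univ.elim_finite_subcover_image h𝒰.1 (sUnion_eq_biUnion ▸ h𝒰.2.ge)
  exact Nat.sInf_mem (s := {n : ℕ | ∃ F : Finset (Set X), ↑F ⊆ 𝒰 ∧ F.card = n ∧
    ⋃₀ (F : Set (Set X)) = Set.univ})
    ⟨_, hTfin.toFinset, by simpa using hT, rfl, by
      rw [hTfin.coe_toFinset, sUnion_eq_biUnion]; exact univ_subset_iff.1 hTcov⟩

/-- Points no two of which lie in a common member of `𝒰` bound `coverN 𝒰` from below. -/
lemma IsOpenCover.card_le_coverN [TopologicalSpace X] [CompactSpace X] {𝒰 : Set (Set X)}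
    (h𝒰 : IsOpenCover 𝒰) {ι : Type*} [Fintype ι] (p : ι → X)
    (hp : ∀ U ∈ 𝒰, ∀ a b, p a ∈ U → p b ∈ U → a = b) :
    Fintype.card ι ≤ coverN 𝒰 := by
  obtain ⟨F, hF, hcard, hcov⟩ := h𝒰.exists_card_eq_coverN
  have hex : ∀ a, ∃ U ∈ F, p a ∈ U := fun a => by
    simpa using (hcov ▸ mem_univ (p a) : p a ∈ ⋃₀ (F : Set (Set X)))
  choose u hu hpu using hex
  rw [← hcard, ← Fintype.card_coe F]
  refine Fintype.card_le_of_injective (fun a => (⟨u a, hu a⟩ : F)) fun a b hab => ?_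
  have hab' : u a = u b := congrArg Subtype.val hab
  exact hp (u a) (hF (hu a)) a b (hpu a) (hab' ▸ hpu b)

lemma isOpenCover_range_ball [PseudoMetricSpace X] {δ : ℝ} (hδ : 0 < δ) :
    IsOpenCover (range fun x : X => Metric.ball x δ) := by
  refine ⟨?_, eq_univ_of_forall fun x => ⟨_, ⟨x, rfl⟩, Metric.mem_ball_self hδ⟩⟩
  rintro _ ⟨x, rfl⟩
  exact Metric.isOpen_ball

end CoverNumber

section PatternCount

variable {G X : Type*}

lemma IsOpenCover.joinPull [TopologicalSpace X] {α : G → X → X} (hα : ∀ g, Continuous (α g))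
    {𝒰 : Set (Set X)} (h𝒰 : IsOpenCover 𝒰) {n : ℕ} (g : Fin n → G) :
    IsOpenCover (joinPull α 𝒰 g) := by
  constructor
  · rintro _ ⟨U, hU, rfl⟩
    exact isOpen_iInter_of_finite fun i => (h𝒰.1 _ (hU i)).preimage (hα _)
  · refine eq_univ_of_forall fun x => ?_
    have hex : ∀ i, ∃ U ∈ 𝒰, α (g i) x ∈ U := fun i => by
      simpa using (h𝒰.2 ▸ mem_univ _ : α (g i) x ∈ ⋃₀ 𝒰)
    choose U hU hxU using hex
    exact ⟨_, ⟨U, hU, rfl⟩, mem_iInter.2 hxU⟩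

lemma coverN_joinPull_le_pow [TopologicalSpace X] [CompactSpace X] (α : G → X → X)
    {𝒰 : Set (Set X)} (h𝒰 : IsOpenCover 𝒰) {n : ℕ} (g : Fin n → G) :
    coverN (joinPull α 𝒰 g) ≤ coverN 𝒰 ^ n := by
  obtain ⟨F, hF, hcard, hcov⟩ := h𝒰.exists_card_eq_coverN
  have := coverN_le_card (𝒰 := joinPull α 𝒰 g)
    (fun φ : Fin n → F => ⋂ i, α (g i) ⁻¹' (φ i : Set X)) (fun x => ?_)
    (fun φ => ⟨_, ⟨fun i => φ i, fun i => hF (φ i).2, rfl⟩, Subset.rfl⟩)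
  · simpa [hcard] using this
  · have hex : ∀ i, ∃ U ∈ F, α (g i) x ∈ U := fun i => by
      simpa using (hcov ▸ mem_univ _ : α (g i) x ∈ ⋃₀ (F : Set (Set X)))
    choose U hU hxU using hex
    exact ⟨fun i => ⟨U i, hU i⟩, mem_iInter.2 hxU⟩

lemma coverN_joinPull_le_patN [TopologicalSpace X] [CompactSpace X] (α : G → X → X)
    {𝒰 : Set (Set X)} (h𝒰 : IsOpenCover 𝒰) {n : ℕ} (g : Fin n → G) :
    coverN (joinPull α 𝒰 g) ≤ patN α 𝒰 n := by
  refine le_csSup ⟨coverN 𝒰 ^ n, ?_⟩ ⟨g, rfl⟩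
  rintro _ ⟨g', rfl⟩
  exact coverN_joinPull_le_pow α h𝒰 g'

lemma exists_patN_eq [Nonempty G] [TopologicalSpace X] [CompactSpace X] (α : G → X → X)
    {𝒰 : Set (Set X)} (h𝒰 : IsOpenCover 𝒰) (n : ℕ) :
    ∃ g : Fin n → G, patN α 𝒰 n = coverN (joinPull α 𝒰 g) := by
  refine Nat.sSup_mem (s := {m : ℕ | ∃ g : Fin n → G, m = coverN (joinPull α 𝒰 g)})
    ⟨_, fun _ => Classical.arbitrary G, rfl⟩ ⟨coverN 𝒰 ^ n, ?_⟩
  rintro _ ⟨g', rfl⟩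
  exact coverN_joinPull_le_pow α h𝒰 g'

end PatternCount

section Separated

variable {G X : Type*} [PseudoMetricSpace X]

/-- Distinct points of `E` are `δ`-apart after applying some `α (g i)`. -/
def IsPatternSeparated (α : G → X → X) {n : ℕ} (g : Fin n → G) (δ : ℝ) (E : Finset X) : Prop :=
  ∀ x ∈ E, ∀ y ∈ E, (∀ i, dist (α (g i) x) (α (g i) y) < δ) → x = y

lemma IsPatternSeparated.pow_card_le_coverN [CompactSpace X] {α : G → X → X}
    (hα : ∀ g, Continuous (α g)) {n : ℕ} {g : Fin n → G} {δ : ℝ} (hδ : 0 < δ) {E : Finset X}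
    (hE : IsPatternSeparated α g δ E) (k : ℕ) :
    E.card ^ k ≤ coverN (joinPull (fun (g : G) (x : Fin k → X) (i : Fin k) => α g (x i))
      (range fun x : Fin k → X => Metric.ball x (δ / 2)) g) := by
  have hcov := (isOpenCover_range_ball (X := Fin k → X) (half_pos hδ)).joinPull
    (α := fun (g : G) (x : Fin k → X) (i : Fin k) => α g (x i))
    (fun g => continuous_pi fun i => (hα g).comp (continuous_apply i)) g
  have := hcov.card_le_coverN (fun (φ : Fin k → E) j => (φ j : X)) ?_
  · simpa using this
  rintro _ ⟨U, hU, rfl⟩ a b ha hb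
  funext j
  refine Subtype.ext (hE _ (a j).2 _ (b j).2 fun i => ?_)
  obtain ⟨c, hc⟩ := hU i
  have ha' := mem_iInter.1 ha i
  have hb' := mem_iInter.1 hb i
  rw [← hc] at ha' hb'
  calc dist (α (g i) (a j)) (α (g i) (b j))
      ≤ dist (α (g i) (a j)) (c j) + dist (α (g i) (b j)) (c j) := dist_triangle_right _ _ _
    _ < δ / 2 + δ / 2 := add_lt_add ((dist_le_pi_dist _ _ j).trans_lt ha')
        ((dist_le_pi_dist _ _ j).trans_lt hb')
    _ = δ := add_halves δ

/-- A maximal separated set also spans, hence bounds covering numbers from above. -/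
lemma exists_isPatternSeparated_coverN_le_card [CompactSpace X] {α : G → X → X}
    (hα : ∀ g, Continuous (α g)) {n : ℕ} (g : Fin n → G) {δ : ℝ} (hδ : 0 < δ)
    {𝒰 : Set (Set X)} (hleb : ∀ x, ∃ U ∈ 𝒰, Metric.ball x δ ⊆ U) :
    ∃ E, IsPatternSeparated α g δ E ∧ coverN (joinPull α 𝒰 g) ≤ E.card := by
  obtain ⟨E, hE, hmax⟩ : ∃ E, IsPatternSeparated α g δ E ∧
      ∀ E', IsPatternSeparated α g δ E' → E'.card ≤ E.card := by
    have hbdd : BddAbove {m | ∃ E, IsPatternSeparated α g δ E ∧ E.card = m} := by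
      refine ⟨coverN (joinPull (fun (g : G) (x : Fin 1 → X) (i : Fin 1) => α g (x i))
        (range fun x : Fin 1 → X => Metric.ball x (δ / 2)) g), ?_⟩
      rintro _ ⟨E, hE, rfl⟩
      simpa using hE.pow_card_le_coverN hα hδ 1
    obtain ⟨E, hE, hcard⟩ := Nat.sSup_mem (s := {m | ∃ E, IsPatternSeparated α g δ E ∧ E.card = m})
      ⟨0, ∅, by simp [IsPatternSeparated], rfl⟩ hbdd
    exact ⟨E, hE, fun E' hE' => hcard ▸ le_csSup hbdd ⟨E', hE', rfl⟩⟩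
  refine ⟨E, hE, ?_⟩
  have := coverN_le_card (𝒰 := joinPull α 𝒰 g)
    (fun y : E => ⋂ i, α (g i) ⁻¹' Metric.ball (α (g i) y) δ) (fun x => ?_) (fun y => ?_)
  · simpa using this
  · by_cases hx : x ∈ E
    · exact ⟨⟨x, hx⟩, mem_iInter.2 fun i => Metric.mem_ball_self hδ⟩
    by_contra! hcon
    have hfar : ∀ y ∈ E, ¬ ∀ i, dist (α (g i) x) (α (g i) y) < δ := fun y hy h =>
      hcon ⟨y, hy⟩ (mem_iInter.2 h)
    have hins : IsPatternSeparated α g δ (insert x E) := by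
      intro a ha b hb hab
      rcases Finset.mem_insert.1 ha with hax | ha <;> rcases Finset.mem_insert.1 hb with hbx | hb
      · exact hax.trans hbx.symm
      · exact absurd (hax ▸ hab) (hfar b hb)
      · exact absurd (fun i => hbx ▸ dist_comm (α (g i) a) (α (g i) b) ▸ hab i) (hfar a ha)
      · exact hE a ha b hb hab
    have := hmax _ hins
    rw [Finset.card_insert_of_notMem hx] at this
    omega
  · choose U hU hball using fun i => hleb (α (g i) y)
    exact ⟨_, ⟨U, hU, rfl⟩, iInter_mono fun i => preimage_mono (hball i)⟩

end Separated

section Power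

variable {G X : Type*}

lemma IsOpenCover.exists_ball_subset [PseudoMetricSpace X] [CompactSpace X] {𝒰 : Set (Set X)}
    (h𝒰 : IsOpenCover 𝒰) : ∃ δ > 0, ∀ x, ∃ U ∈ 𝒰, Metric.ball x δ ⊆ U := by
  simpa using lebesgue_number_lemma_of_metric_sUnion isCompact_univ h𝒰.1 h𝒰.2.ge

lemma exists_patN_pow_le [Nonempty G] [PseudoMetricSpace X] [CompactSpace X] {α : G → X → X}
    (hα : ∀ g, Continuous (α g)) (k : ℕ) {𝒰 : Set (Set X)} (h𝒰 : IsOpenCover 𝒰) :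
    ∃ 𝒱 : Set (Set (Fin k → X)), IsOpenCover 𝒱 ∧ ∀ n, patN α 𝒰 n ^ k ≤
      patN (fun (g : G) (x : Fin k → X) (i : Fin k) => α g (x i)) 𝒱 n := by
  obtain ⟨δ, hδ, hleb⟩ := h𝒰.exists_ball_subset
  have hcov := isOpenCover_range_ball (X := Fin k → X) (half_pos hδ)
  refine ⟨_, hcov, fun n => ?_⟩
  obtain ⟨g, hg⟩ := exists_patN_eq α h𝒰 n
  obtain ⟨E, hE, hcard⟩ := exists_isPatternSeparated_coverN_le_card hα g hδ hleb
  calc patN α 𝒰 n ^ k ≤ E.card ^ k := by rw [hg]; gcongr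
    _ ≤ _ := hE.pow_card_le_coverN hα hδ k
    _ ≤ _ := coverN_joinPull_le_patN _ hcov g

lemma exists_patN_le_pow [Nonempty G] [PseudoMetricSpace X] [CompactSpace X] {α : G → X → X}
    (hα : ∀ g, Continuous (α g)) (k : ℕ) {𝒱 : Set (Set (Fin k → X))} (h𝒱 : IsOpenCover 𝒱) :
    ∃ 𝒰 : Set (Set X), IsOpenCover 𝒰 ∧ ∀ n,
      patN (fun (g : G) (x : Fin k → X) (i : Fin k) => α g (x i)) 𝒱 n ≤ patN α 𝒰 n ^ k := by
  obtain ⟨δ, hδ, hleb⟩ := h𝒱.exists_ball_subset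
  have hcov := isOpenCover_range_ball (X := X) hδ
  refine ⟨_, hcov, fun n => ?_⟩
  obtain ⟨g, hg⟩ := exists_patN_eq
    (fun (g : G) (x : Fin k → X) (i : Fin k) => α g (x i)) h𝒱 n
  obtain ⟨F, hF, hcard, hFcov⟩ := (hcov.joinPull hα g).exists_card_eq_coverN
  rw [hg]
  refine le_trans ?_ (Nat.pow_le_pow_left (coverN_joinPull_le_patN α hcov g) k)
  rw [← hcard]
  have := coverN_le_card (𝒰 := joinPull
    (fun (g : G) (x : Fin k → X) (i : Fin k) => α g (x i)) 𝒱 g)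
    (fun φ : Fin k → F => {x | ∀ j, x j ∈ (φ j : Set X)}) (fun x => ?_) (fun φ => ?_)
  · simpa using this
  · have hex : ∀ j, ∃ U ∈ F, x j ∈ U := fun j => by
      simpa using (hFcov ▸ mem_univ _ : x j ∈ ⋃₀ (F : Set (Set X)))
    choose U hU hxU using hex
    exact ⟨fun j => ⟨U j, hU j⟩, hxU⟩
  · choose U hU hφ using fun j => hF (φ j).2
    choose c hc using hU
    choose V hV hball using fun i => hleb fun j => c j i
    refine ⟨_, ⟨V, hV, rfl⟩, fun x hx => mem_iInter.2 fun i => hball i ?_⟩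
    rw [ball_pi _ hδ]
    intro j _
    have hxj := hx j
    rw [hφ j] at hxj
    have := mem_iInter.1 hxj i
    rwa [← hc j i] at this

lemma log_natCast_le_log_natCast {a b : ℕ} (h : a ≤ b) : Real.log a ≤ Real.log b := by
  rcases Nat.eq_zero_or_pos a with rfl | ha
  · simpa using Real.log_natCast_nonneg b
  · exact Real.log_le_log (by exact_mod_cast ha) (by exact_mod_cast h)

lemma ofReal_log_pow_div (a k n : ℕ) :
    ENNReal.ofReal (Real.log ((a ^ k : ℕ) : ℝ) / n)
      = (k : ℝ≥0∞) * ENNReal.ofReal (Real.log a / n) := by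
  rw [Nat.cast_pow, Real.log_pow, mul_div_assoc, ENNReal.ofReal_mul (by positivity),
    ENNReal.ofReal_natCast]

lemma limsup_ofReal_log_pow_div (a : ℕ → ℕ) (k : ℕ) :
    atTop.limsup (fun n : ℕ => ENNReal.ofReal (Real.log ((a n ^ k : ℕ) : ℝ) / n))
      = (k : ℝ≥0∞) * atTop.limsup fun n : ℕ => ENNReal.ofReal (Real.log (a n) / n) := by
  simp_rw [ofReal_log_pow_div]
  exact ENNReal.limsup_const_mul_of_ne_top (ENNReal.natCast_ne_top k)

lemma limsup_ofReal_log_div_mono {a b : ℕ → ℕ} (h : ∀ n, a n ≤ b n) :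
    atTop.limsup (fun n : ℕ => ENNReal.ofReal (Real.log (a n) / n))
      ≤ atTop.limsup fun n : ℕ => ENNReal.ofReal (Real.log (b n) / n) :=
  limsup_le_limsup (Eventually.of_forall fun n => ENNReal.ofReal_le_ofReal
    (div_le_div_of_nonneg_right (log_natCast_le_log_natCast (h n)) n.cast_nonneg))

end Power

/-- Goodman, Huang–Ye: `h*_top(X^k,G,α^k) = k · h*_top(X,G,α)`. -/
theorem maximal_pattern_entropy_prod_pow
    {G X : Type*} [Group G] [Countable G] [Infinite G] [MetricSpace X] [CompactSpace X]
    (α : G → X → X) (hα : IsActionBy α) (k : ℕ) :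
    patEnt (fun (g : G) (x : Fin k → X) (i : Fin k) => α g (x i))
      = (k : ℝ≥0∞) * patEnt α := by
  refine le_antisymm (iSup₂_le fun 𝒱 h𝒱 => ?_) ?_
  · obtain ⟨𝒰, h𝒰, hle⟩ := exists_patN_le_pow hα.2.2 k h𝒱
    calc _ ≤ _ := limsup_ofReal_log_div_mono hle
      _ = k * patEntCover α 𝒰 := limsup_ofReal_log_pow_div _ k
      _ ≤ _ := by gcongr; exact le_iSup₂_of_le 𝒰 h𝒰 le_rfl
  · simp_rw [patEnt, ENNReal.mul_iSup]
    refine iSup₂_le fun 𝒰 h𝒰 => ?_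
    obtain ⟨𝒱, h𝒱, hle⟩ := exists_patN_pow_le hα.2.2 k h𝒰
    calc _ = _ := (limsup_ofReal_log_pow_div _ k).symm
      _ ≤ _ := limsup_ofReal_log_div_mono hle
      _ ≤ _ := le_iSup₂_of_le 𝒱 h𝒱 le_rfl
end

section
/- Let π: (X,G,α) → (Y,G,β) be a G-factor map between topological dynamical systems and k ∈ ℕ. Then (π×…×π)(IN_k(X,G)) = IN_k(Y,G). -/
open Filter Topology Set
open scoped ENNReal Classical

section Independence

variable {G X : Type*} {k : ℕ} {α : G → X → X}

lemma IsIndepSet.mono {A B : Fin k → Set X} {I : Set G} (h : IsIndepSet α A I)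
    (hAB : ∀ i, A i ⊆ B i) : IsIndepSet α B I := fun F hF hne ω => by
  obtain ⟨x, hx⟩ := h F hF hne ω
  exact ⟨x, by simp only [mem_iInter] at hx ⊢; exact fun g hg => hAB _ (hx g hg)⟩

lemma HasArbLargeIndep.mono {A B : Fin k → Set X} (h : HasArbLargeIndep α A)
    (hAB : ∀ i, A i ⊆ B i) : HasArbLargeIndep α B := fun n => by
  obtain ⟨F, hn, hF⟩ := h n
  exact ⟨F, hn, hF.mono hAB⟩

lemma HasArbLargeIndep.nonempty {A : Fin k → Set X} (h : HasArbLargeIndep α A) (i : Fin k) :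
    (A i).Nonempty := by
  obtain ⟨F, hn, hF⟩ := h 1
  obtain ⟨g, hg⟩ := Finset.card_pos.1 hn
  obtain ⟨x, hx⟩ := hF F subset_rfl ⟨g, hg⟩ fun _ => i
  exact ⟨α g x, by simpa using mem_iInter₂.1 hx g hg⟩

/-- The points of a combinatorial line over a set of pairs, projected through `f`:
`x` on the active coordinates, and `f` of the fixed entry elsewhere. -/
def lineProj {E V ι : Type*} (l : Combinatorics.Line E ι) (f : E → V) (x : V) : ι → V :=
  fun j => (l.idxFun j).elim x f

lemma lineProj_injective {E V ι : Type*} (l : Combinatorics.Line E ι) (f : E → V) :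
    Function.Injective (lineProj l f) := fun x y h => by
  obtain ⟨j, hj⟩ := l.proper
  simpa [lineProj, hj] using congrFun h j

lemma lineProj_apply {E V ι : Type*} (l : Combinatorics.Line E ι) (f : E → V) (e : E) :
    lineProj l f (f e) = fun j => f (l e j) := by
  funext j
  cases h : l.idxFun j <;> simp [lineProj, h]

/-- The symbol of a pair of points in a power of `V × (V → Fin k)`: a symbol different from `i`
occurring among the coordinates, or `i` if there is none. -/
noncomputable def powSymbol {V ι : Type*} (i : Fin k) (v : ι → V) (w : ι → V → Fin k) : Fin k :=
  if h : ∃ j, w j (v j) ≠ i then w h.choose (v h.choose) else i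

lemma powSymbol_eq {V ι : Type*} {i : Fin k} {v : ι → V} {w : ι → V → Fin k}
    (h : ∀ j, w j (v j) = i) : powSymbol i v w = i :=
  dif_neg (by simpa using h)

lemma powSymbol_lineProj {V ι : Type*} {i : Fin k}
    (l : Combinatorics.Line {e : V × (V → Fin k) // e.2 e.1 = i} ι) (v : V) (w : V → Fin k) :
    powSymbol i (lineProj l (fun e => e.1.1) v) (lineProj l (fun e => e.1.2) w) = w v := by
  have key : ∀ j, (lineProj l (fun e => e.1.2) w j) (lineProj l (fun e => e.1.1) v j) = i ∨
      (lineProj l (fun e => e.1.2) w j) (lineProj l (fun e => e.1.1) v j) = w v := by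
    intro j
    cases h : l.idxFun j with
    | none => right; simp [lineProj, h]
    | some e => left; simpa [lineProj, h] using e.2
  unfold powSymbol
  split_ifs with h
  · exact (key _).resolve_left h.choose_spec
  · push Not at h
    obtain ⟨j, hj⟩ := l.proper
    rw [← h j]
    simp [lineProj, hj]

/-- Partition regularity of independence at a fixed size, by the Hales–Jewett theorem. -/
lemma HasArbLargeIndep.exists_indepSet_update {κ : Type*} [Finite κ] {A : Fin k → Set X}
    (h : HasArbLargeIndep α A) (i : Fin k) (B : κ → Set X) (hB : A i ⊆ ⋃ c, B c) (n : ℕ) :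
    ∃ c, ∃ F : Finset G, n ≤ F.card ∧ IsIndepSet α (Function.update A i (B c)) ↑F := by
  let V := Fin (n + 1)
  let E := {e : V × (V → Fin k) // e.2 e.1 = i}
  obtain ⟨ι, _, hι⟩ := Combinatorics.Line.exists_mono_in_high_dimension E κ
  obtain ⟨I, hcard, hI⟩ := h (Fintype.card (ι → V))
  obtain ⟨φ⟩ : Nonempty ((ι → V) ↪ I) :=
    Function.Embedding.nonempty_of_card_le (by simpa using hcard)
  let ψ : (ι → V) → G := fun v => φ v
  have hψ : Function.Injective ψ := Subtype.val_injective.comp φ.injective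
  have hpt : ∀ w : ι → V → Fin k, ∃ x, ∀ v, α (ψ v) x ∈ A (powSymbol i v w) := by
    intro w
    obtain ⟨x, hx⟩ := hI I subset_rfl ⟨_, (φ fun _ => 0).2⟩
      (Function.extend ψ (fun v => powSymbol i v w) fun _ => i)
    refine ⟨x, fun v => ?_⟩
    have := mem_iInter₂.1 hx (ψ v) (φ v).2
    rwa [hψ.extend_apply] at this
  choose x hx using hpt
  have hcol : ∀ e : ι → E, ∃ c, α (ψ fun j => (e j).1.1) (x fun j => (e j).1.2) ∈ B c := by
    intro e
    have := hx (fun j => (e j).1.2) fun j => (e j).1.1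
    rw [powSymbol_eq fun j => (e j).2] at this
    simpa using hB this
  choose C hC using hcol
  obtain ⟨l, c, hl⟩ := hι C
  let p : V → G := fun v => ψ (lineProj l (fun e => e.1.1) v)
  have hp : Function.Injective p := hψ.comp (lineProj_injective l _)
  refine ⟨c, Finset.univ.image p, ?_, fun F hF _ ω => ?_⟩
  · rw [Finset.card_image_of_injective _ hp]
    simp [V]
  let w : V → Fin k := fun v => ω (p v)
  refine ⟨x (lineProj l (fun e => e.1.2) w), mem_iInter₂.2 fun g hg => ?_⟩
  obtain ⟨v, rfl⟩ : ∃ v, p v = g := by simpa using hF hg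
  by_cases hv : w v = i
  · let e : E := ⟨(v, w), hv⟩
    have h1 := hC (l e)
    rw [hl e, ← lineProj_apply l (fun e => e.1.1), ← lineProj_apply l (fun e => e.1.2)] at h1
    have h2 : ω (p v) = i := hv
    rw [h2, Function.update_self]
    exact h1
  · have h1 := hx (lineProj l (fun e => e.1.2) w) (lineProj l (fun e => e.1.1) v)
    rw [powSymbol_lineProj] at h1
    rw [Function.update_of_ne hv]
    exact h1

lemma HasArbLargeIndep.exists_update {κ : Type*} [Finite κ] {A : Fin k → Set X}
    (h : HasArbLargeIndep α A) (i : Fin k) (B : κ → Set X) (hB : A i ⊆ ⋃ c, B c) :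
    ∃ c, HasArbLargeIndep α (Function.update A i (B c)) := by
  by_contra! hc
  simp only [HasArbLargeIndep, not_forall] at hc
  choose N hN using hc
  obtain ⟨M, hM⟩ := (Set.finite_range N).bddAbove
  obtain ⟨c, F, hF, hF'⟩ := h.exists_indepSet_update i B hB M
  exact hN c ⟨F, (hM ⟨c, rfl⟩).trans hF, hF'⟩

/-- Every choice of members of the filters `L i` has arbitrarily large finite
independence sets. -/
def FilterIndep (α : G → X → X) (L : Fin k → Filter X) : Prop :=
  ∀ A : Fin k → Set X, (∀ i, A i ∈ L i) → HasArbLargeIndep α A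

lemma FilterIndep.mono {L M : Fin k → Filter X} (h : FilterIndep α L) (hLM : ∀ i, L i ≤ M i) :
    FilterIndep α M := fun A hA => h A fun i => hLM i (hA i)

lemma FilterIndep.neBot {L : Fin k → Filter X} (h : FilterIndep α L) (i : Fin k) :
    (L i).NeBot := by
  refine ⟨fun hi => ?_⟩
  simpa using (h (Function.update (fun _ => univ) i ∅) fun j => by
    rcases eq_or_ne j i with rfl | hj
    · simp [hi]
    · simp [hj]).nonempty i

lemma FilterIndep.exists_update_inf_nhds [TopologicalSpace X] [CompactSpace X]
    {L : Fin k → Filter X} (h : FilterIndep α L) (i : Fin k) :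
    ∃ x, FilterIndep α (Function.update L i (L i ⊓ 𝓝 x)) := by
  by_contra! hc
  simp only [FilterIndep, not_forall] at hc
  choose A hA hAn using hc
  have hAi : ∀ x, A x i ∈ L i ⊓ 𝓝 x := fun x => by simpa using hA x i
  have hAj : ∀ x j, j ≠ i → A x j ∈ L j := fun x j hj => by simpa [hj] using hA x j
  choose S hS U hU hSU using fun x => Filter.mem_inf_iff_superset.1 (hAi x)
  obtain ⟨t, -, ht⟩ := isCompact_univ.elim_nhds_subcover U fun x _ => hU x
  let D : Fin k → Set X := fun j => ⋂ x ∈ t, if j = i then S x else A x j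
  have hD : HasArbLargeIndep α D := h D fun j => by
    refine (Filter.biInter_finset_mem t).2 fun x _ => ?_
    split_ifs with hj
    · exact hj ▸ hS x
    · exact hAj x j hj
  obtain ⟨⟨x, hx⟩, hxD⟩ := hD.exists_update i (fun x : t => D i ∩ U x) fun z hz => by
    obtain ⟨x, hx, hzx⟩ := mem_iUnion₂.1 (ht (mem_univ z))
    exact mem_iUnion.2 ⟨⟨x, hx⟩, hz, hzx⟩
  refine hAn x (hxD.mono fun j => ?_)
  rcases eq_or_ne j i with rfl | hj
  · rw [Function.update_self]
    refine fun z hz => hSU x ⟨?_, hz.2⟩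
    simpa using mem_iInter₂.1 hz.1 x hx
  · rw [Function.update_of_ne hj]
    intro z hz
    simpa [hj] using mem_iInter₂.1 hz x hx

lemma FilterIndep.exists_inf_nhds [TopologicalSpace X] [CompactSpace X]
    {L : Fin k → Filter X} (h : FilterIndep α L) :
    ∃ x : Fin k → X, FilterIndep α fun i => L i ⊓ 𝓝 (x i) := by
  suffices H : ∀ s : Finset (Fin k), ∃ M : Fin k → Filter X, FilterIndep α M ∧
      (∀ i, M i ≤ L i) ∧ ∀ i ∈ s, ∃ x, M i ≤ 𝓝 x by
    obtain ⟨M, hM, hML, hx⟩ := H Finset.univ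
    choose x hx using fun i => hx i (Finset.mem_univ i)
    exact ⟨x, hM.mono fun i => le_inf (hML i) (hx i)⟩
  intro s
  induction s using Finset.induction_on with
  | empty => exact ⟨L, h, fun _ => le_rfl, by simp⟩
  | insert i s _ ih =>
    obtain ⟨M, hM, hML, hs⟩ := ih
    obtain ⟨x, hx⟩ := hM.exists_update_inf_nhds i
    have hle : ∀ j, Function.update M i (M i ⊓ 𝓝 x) j ≤ M j := fun j => by
      rcases eq_or_ne j i with rfl | hj
      · simp
      · simp [hj]
    refine ⟨_, hx, fun j => (hle j).trans (hML j), fun j hj => ?_⟩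
    rcases eq_or_ne j i with rfl | hji
    · exact ⟨x, by simp⟩
    · obtain ⟨z, hz⟩ := hs j ((Finset.mem_insert.1 hj).resolve_left hji)
      exact ⟨z, (hle j).trans hz⟩

lemma isINTuple_iff_filterIndep [TopologicalSpace X] {x : Fin k → X} :
    IsINTuple α x ↔ FilterIndep α fun i => 𝓝 (x i) := by
  refine ⟨fun h A hA => ?_, fun h U hU hx => h U fun i => (hU i).mem_nhds (hx i)⟩
  exact (h (fun i => interior (A i)) (fun _ => isOpen_interior)
    fun i => mem_interior_iff_mem_nhds.2 (hA i)).mono fun i => interior_subset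

variable {Y : Type*} {β : G → Y → Y} {π : X → Y}

lemma isIndepSet_preimage_iff (hπs : Function.Surjective π)
    (hπ : ∀ g x, π (α g x) = β g (π x)) {A : Fin k → Set Y} {I : Set G} :
    IsIndepSet α (fun i => π ⁻¹' A i) I ↔ IsIndepSet β A I := by
  simp only [IsIndepSet, Set.Nonempty, mem_iInter, mem_preimage, hπ, hπs.exists]

lemma filterIndep_comap_iff (hπs : Function.Surjective π)
    (hπ : ∀ g x, π (α g x) = β g (π x)) {L : Fin k → Filter Y} :
    FilterIndep α (fun i => comap π (L i)) ↔ FilterIndep β L := by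
  constructor
  · intro h A hA n
    obtain ⟨F, hn, hF⟩ := h (fun i => π ⁻¹' A i) (fun i => preimage_mem_comap (hA i)) n
    exact ⟨F, hn, (isIndepSet_preimage_iff hπs hπ).1 hF⟩
  · intro h A hA n
    choose B hB hBA using hA
    obtain ⟨F, hn, hF⟩ := h B hB n
    exact ⟨F, hn, ((isIndepSet_preimage_iff hπs hπ).2 hF).mono hBA⟩

end Independence

/-- Kerr–Li: a factor map sends `INₖ(X,G)` onto `INₖ(Y,G)`. -/
theorem factor_map_image_INTuples
    {G X Y : Type*} [Group G] [Countable G] [Infinite G]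
    [MetricSpace X] [CompactSpace X] [MetricSpace Y] [CompactSpace Y]
    (α : G → X → X) (hα : IsActionBy α) (β : G → Y → Y) (hβ : IsActionBy β)
    (π : X → Y) (hπc : Continuous π) (hπs : Function.Surjective π)
    (hπ : ∀ g x, π (α g x) = β g (π x)) (k : ℕ) :
    (fun x : Fin k → X => π ∘ x) '' {x | IsINTuple α x} = {y : Fin k → Y | IsINTuple β y} := by
  ext y
  constructor
  · rintro ⟨x, hx, rfl⟩
    refine isINTuple_iff_filterIndep.2 ((filterIndep_comap_iff hπs hπ).1 ?_)
    exact (isINTuple_iff_filterIndep.1 hx).mono fun i => (hπc.tendsto (x i)).le_comap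
  · intro hy
    obtain ⟨x, hx⟩ :=
      ((filterIndep_comap_iff hπs hπ).2 (isINTuple_iff_filterIndep.1 hy)).exists_inf_nhds
    refine ⟨x, isINTuple_iff_filterIndep.2 (hx.mono fun i => inf_le_right), funext fun i => ?_⟩
    have := hx.neBot i
    exact tendsto_nhds_unique
      (((hπc.tendsto (x i)).mono_left inf_le_right : Tendsto π (comap π (𝓝 (y i)) ⊓ 𝓝 (x i)) _))
      (tendsto_comap.mono_left inf_le_left)
end
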